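/- Let G : ℝ² → ℝ² be a continuously differentiable map which is unipotent, nonlinear, and satisfies G(0,0) = (0,0). For μ ∈ ℝ define G_μ : ℝ² → ℝ² by G_μ(z) = G(z) − μ·z. Then for every μ with −1 < μ < 0, the map G_μ is a bijection of ℝ², and the origin is a global repellor for G_μ: there is a map H : ℝ² → ℝ² with H ∘ G_μ = id and G_μ ∘ H = id, and for every z ∈ ℝ² the iterates H^n(z) converge to (0,0) as n → +∞. -/

import Mathlib

open Filter Topology

/-- A differentiable planar map is *unipotent* if at every point the Jacobian has
both eigenvalues equal to `1`; equivalently the trace of the Jacobian is `2` and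
its determinant is `1` everywhere. -/
def Unipotent (G : ℝ × ℝ → ℝ × ℝ) : Prop :=
  ∀ z : ℝ × ℝ,
    (fderiv ℝ G z (1, 0)).1 + (fderiv ℝ G z (0, 1)).2 = 2 ∧
    (fderiv ℝ G z (1, 0)).1 * (fderiv ℝ G z (0, 1)).2 -
      (fderiv ℝ G z (0, 1)).1 * (fderiv ℝ G z (1, 0)).2 = 1

/-- A planar map is *nonlinear* if its derivative is not constant, i.e. it is not affine. -/
def NonlinearMap (G : ℝ × ℝ → ℝ × ℝ) : Prop :=
  ¬ ∃ A : (ℝ × ℝ) →L[ℝ] ℝ × ℝ, ∀ z : ℝ × ℝ, fderiv ℝ G z = A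

/-- A real function is *nonlinear* if it is not of the form `t ↦ k * t`. -/
def NonlinearFun (ψ : ℝ → ℝ) : Prop :=
  ¬ ∃ k : ℝ, ∀ t : ℝ, ψ t = k * t

/-- The linear rotation by angle `θ`. -/
noncomputable def Rot (θ : ℝ) (p : ℝ × ℝ) : ℝ × ℝ :=
  (p.1 * Real.cos θ - p.2 * Real.sin θ, p.1 * Real.sin θ + p.2 * Real.cos θ)


/-- The Jacobian matrix of `(P, Q)` is `!![a, b; c, -a]`, nilpotent and continuous. -/
structure HasNilpotentJacobian (P Q a b c : ℝ × ℝ → ℝ) : Prop where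
  hasFDerivAt_left (z : ℝ × ℝ) : HasFDerivAt P
    (a z • ContinuousLinearMap.fst ℝ ℝ ℝ + b z • ContinuousLinearMap.snd ℝ ℝ ℝ) z
  hasFDerivAt_right (z : ℝ × ℝ) : HasFDerivAt Q
    (c z • ContinuousLinearMap.fst ℝ ℝ ℝ - a z • ContinuousLinearMap.snd ℝ ℝ ℝ) z
  sq_add_mul (z : ℝ × ℝ) : a z ^ 2 + b z * c z = 0
  continuous_a : Continuous a
  continuous_b : Continuous b

/-- The isomorphism `(u, v) ↦ (u, a u + b v)`. -/
noncomputable def shearEquiv (a b : ℝ) (hb : b ≠ 0) : (ℝ × ℝ) ≃L[ℝ] ℝ × ℝ :=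
  ContinuousLinearEquiv.equivOfInverse
    ((ContinuousLinearMap.fst ℝ ℝ ℝ).prod
      (a • ContinuousLinearMap.fst ℝ ℝ ℝ + b • ContinuousLinearMap.snd ℝ ℝ ℝ))
    ((ContinuousLinearMap.fst ℝ ℝ ℝ).prod
      (b⁻¹ • ContinuousLinearMap.snd ℝ ℝ ℝ - (a / b) • ContinuousLinearMap.fst ℝ ℝ ℝ))
    (fun z => by ext <;> simp; field_simp; ring)
    (fun z => by ext <;> simp; field_simp; ring)

namespace HasNilpotentJacobian

variable {P Q a b c : ℝ × ℝ → ℝ}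

theorem comp_fst (h : HasNilpotentJacobian P Q a b c) {u v : ℝ → ℝ} {u' v' t : ℝ}
    (hu : HasDerivAt u u' t) (hv : HasDerivAt v v' t) :
    HasDerivAt (fun s => P (u s, v s)) (a (u t, v t) * u' + b (u t, v t) * v') t := by
  convert! (h.hasFDerivAt_left (u t, v t)).comp_hasDerivAt t (hu.prodMk hv) using 1

theorem comp_snd (h : HasNilpotentJacobian P Q a b c) {u v : ℝ → ℝ} {u' v' t : ℝ}
    (hu : HasDerivAt u u' t) (hv : HasDerivAt v v' t) :
    HasDerivAt (fun s => Q (u s, v s)) (c (u t, v t) * u' - a (u t, v t) * v') t := by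
  convert! (h.hasFDerivAt_right (u t, v t)).comp_hasDerivAt t (hu.prodMk hv) using 1

/-- Near a point where `∂P/∂y ≠ 0`, the level sets of `P` are graphs `y = Y x t`. -/
theorem exists_level_graph (h : HasNilpotentJacobian P Q a b c) {p : ℝ × ℝ} (hb : b p ≠ 0) :
    ∃ δ > 0, ∃ Y : ℝ → ℝ → ℝ, Y p.1 (P p) = p.2 ∧
      ∀ x ∈ Metric.ball p.1 δ, ∀ t ∈ Metric.ball (P p) δ,
        b (x, Y x t) ≠ 0 ∧ P (x, Y x t) = t ∧
        HasDerivAt (fun s => Y s t) (-(a (x, Y x t) / b (x, Y x t))) x ∧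
        HasDerivAt (fun s => Y x s) (b (x, Y x t))⁻¹ t := by
  set Φ : ℝ × ℝ → ℝ × ℝ := fun z => (z.1, P z) with hΦ
  have hd : ∀ z (hz : b z ≠ 0), HasFDerivAt Φ (shearEquiv (a z) (b z) hz : ℝ × ℝ →L[ℝ] ℝ × ℝ) z :=
    fun z hz => hasFDerivAt_fst.prodMk (h.hasFDerivAt_left z)
  have hstrictP : HasStrictFDerivAt P
      (a p • ContinuousLinearMap.fst ℝ ℝ ℝ + b p • ContinuousLinearMap.snd ℝ ℝ ℝ) p := by
    refine hasStrictFDerivAt_of_hasFDerivAt_of_continuousAt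
      (.of_forall h.hasFDerivAt_left) ?_
    have h1 := h.continuous_a
    have h2 := h.continuous_b
    exact Continuous.continuousAt (by fun_prop)
  have hstrict : HasStrictFDerivAt Φ (shearEquiv (a p) (b p) hb : ℝ × ℝ →L[ℝ] ℝ × ℝ) p :=
    hasStrictFDerivAt_fst.prodMk hstrictP
  set e := hstrict.toOpenPartialHomeomorph Φ with he
  have hps : p ∈ e.source := hstrict.mem_toOpenPartialHomeomorph_source
  have hecoe : ∀ z, e z = Φ z := fun z => rfl
  have hpt : Φ p ∈ e.target := e.map_source hps
  have hsymm : e.symm (Φ p) = p := e.left_inv hps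
  have hev : ∀ᶠ w in 𝓝 (Φ p), w ∈ e.target ∧ b (e.symm w) ≠ 0 := by
    refine .and (e.open_target.mem_nhds hpt) ?_
    have hc : ContinuousAt (fun w => b (e.symm w)) (Φ p) :=
      h.continuous_b.continuousAt.comp (e.continuousAt_symm hpt)
    exact hc.eventually_ne (by rwa [hsymm])
  obtain ⟨δ, hδ, hball⟩ := Metric.eventually_nhds_iff_ball.1 hev
  refine ⟨δ, hδ, fun x t => (e.symm (x, t)).2, ?_, fun x hx t ht => ?_⟩
  · change (e.symm (Φ p)).2 = p.2
    rw [hsymm]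
  obtain ⟨hT, hbne⟩ := hball (x, t) (by
    rw [← ball_prod_same]; exact ⟨hx, ht⟩)
  have hright : Φ (e.symm (x, t)) = (x, t) := e.right_inv hT
  have hz : (x, (e.symm (x, t)).2) = e.symm (x, t) :=
    Prod.ext (congrArg Prod.fst hright).symm rfl
  have hinv : HasFDerivAt e.symm _ (x, t) := e.hasFDerivAt_symm hT (hd _ hbne)
  have hsnd := hinv.snd
  simp only [hz]
  refine ⟨hbne, congrArg Prod.snd hright, ?_, ?_⟩
  · have := hsnd.comp_hasDerivAt x ((hasDerivAt_id x).prodMk (hasDerivAt_const x t))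
    convert! this using 1
    simp [shearEquiv]
  · have := hsnd.comp_hasDerivAt t ((hasDerivAt_const t x).prodMk (hasDerivAt_id t))
    convert! this using 1
    simp [shearEquiv]

theorem eq_center_of_hasDerivAt_zero_on_ball {f : ℝ → ℝ} {x₀ δ : ℝ}
    (hf : ∀ x ∈ Metric.ball x₀ δ, HasDerivAt f 0 x) {x : ℝ} (hx : x ∈ Metric.ball x₀ δ) :
    f x = f x₀ :=
  Metric.isOpen_ball.is_const_of_deriv_eq_zero (convex_ball x₀ δ).isPreconnected
    (fun y hy => (hf y hy).differentiableAt.differentiableWithinAt)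
    (fun y hy => (hf y hy).deriv) hx (Metric.mem_ball_self (Metric.pos_of_mem_ball hx))

/-- Near a point with `∂P/∂y ≠ 0`, the map `(P, Q)` is constant on a segment, along which
`(∂P/∂y)⁻¹` is affine. -/
theorem exists_segment (h : HasNilpotentJacobian P Q a b c) {p : ℝ × ℝ} (hb : b p ≠ 0)
    {σ : ℝ} (hσ : a p = -σ * b p) :
    ∃ δ > 0, ∃ k : ℝ, ∀ x ∈ Metric.ball p.1 δ,
      P (x, p.2 + σ * (x - p.1)) = P p ∧ Q (x, p.2 + σ * (x - p.1)) = Q p ∧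
      a (x, p.2 + σ * (x - p.1)) = -σ * b (x, p.2 + σ * (x - p.1)) ∧
      b (x, p.2 + σ * (x - p.1)) * ((b p)⁻¹ + k * (x - p.1)) = 1 := by
  obtain ⟨δ, hδ, Y, hY0, hY⟩ := h.exists_level_graph hb
  obtain ⟨x₀, y₀⟩ := p
  simp only at hY0 hY ⊢
  have hx₀ : x₀ ∈ Metric.ball x₀ δ := Metric.mem_ball_self hδ
  have ht₀ : P (x₀, y₀) ∈ Metric.ball (P (x₀, y₀)) δ := Metric.mem_ball_self hδ
  have hR : ∀ x ∈ Metric.ball x₀ δ, ∀ t ∈ Metric.ball (P (x₀, y₀)) δ,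
      Q (x, Y x t) = Q (x₀, Y x₀ t) := fun x hx t ht =>
    eq_center_of_hasDerivAt_zero_on_ball (f := fun x => Q (x, Y x t)) (fun x hx => by
      obtain ⟨hb, -, h1, -⟩ := hY x hx t ht
      have := h.comp_snd (hasDerivAt_id x) h1
      convert! this using 1
      have := h.sq_add_mul (x, Y x t)
      simp only [id]
      field_simp
      linarith) hx
  have hslope : ∀ x ∈ Metric.ball x₀ δ, ∀ t ∈ Metric.ball (P (x₀, y₀)) δ,
      a (x, Y x t) / b (x, Y x t) = a (x₀, Y x₀ t) / b (x₀, Y x₀ t) := fun x hx t ht => by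
    have h1 := h.comp_snd (hasDerivAt_const t x) (hY x hx t ht).2.2.2
    have h2 := h.comp_snd (hasDerivAt_const t x₀) (hY x₀ hx₀ t ht).2.2.2
    have h3 : (fun s => Q (x, Y x s)) =ᶠ[𝓝 t] fun s => Q (x₀, Y x₀ s) :=
      Filter.eventually_of_mem (Metric.isOpen_ball.mem_nhds ht) fun s hs => hR x hx s hs
    have := h1.unique (h2.congr_of_eventuallyEq h3)
    simp only [mul_zero, zero_sub, neg_inj, ← div_eq_mul_inv] at this
    exact this
  have hline : ∀ x ∈ Metric.ball x₀ δ, ∀ t ∈ Metric.ball (P (x₀, y₀)) δ,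
      Y x t = Y x₀ t - a (x₀, Y x₀ t) / b (x₀, Y x₀ t) * (x - x₀) := fun x hx t ht => by
    have := eq_center_of_hasDerivAt_zero_on_ball
      (f := fun x => Y x t + a (x₀, Y x₀ t) / b (x₀, Y x₀ t) * (x - x₀)) (fun x hx => by
        convert! (hY x hx t ht).2.2.1.add
          (((hasDerivAt_id x).sub_const x₀).const_mul (a (x₀, Y x₀ t) / b (x₀, Y x₀ t))) using 1
        rw [hslope x hx t ht]; ring) hx
    linarith
  have hσ' : a (x₀, y₀) / b (x₀, y₀) = -σ := by rw [hσ]; field_simp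
  have hpt : ∀ x ∈ Metric.ball x₀ δ, Y x (P (x₀, y₀)) = y₀ + σ * (x - x₀) := fun x hx => by
    rw [hline x hx _ ht₀, hY0, hσ']; ring
  obtain ⟨k, hk⟩ : ∃ k, HasDerivAt (fun t => -(a (x₀, Y x₀ t) / b (x₀, Y x₀ t))) k
      (P (x₀, y₀)) := by
    have hx₁ : x₀ + δ / 2 ∈ Metric.ball x₀ δ := by
      simp [abs_of_pos hδ, hδ]
    have h1 := (((hY _ hx₁ _ ht₀).2.2.2).sub ((hY _ hx₀ _ ht₀).2.2.2)).div_const (δ / 2)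
    refine ⟨_, h1.congr_of_eventuallyEq ?_⟩
    refine Filter.eventually_of_mem (Metric.isOpen_ball.mem_nhds ht₀) fun t ht => ?_
    change _ = (Y (x₀ + δ / 2) t - Y x₀ t) / (δ / 2)
    rw [hline _ hx₁ t ht]
    field_simp
    ring
  refine ⟨δ, hδ, k, fun x hx => ?_⟩
  obtain ⟨hbx, hPx, -, hYt⟩ := hY x hx _ ht₀
  have hs := hslope x hx _ ht₀
  have hQ := hR x hx _ ht₀
  have hinv : (b (x, Y x (P (x₀, y₀))))⁻¹ = (b (x₀, y₀))⁻¹ + k * (x - x₀) := by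
    have h1 := (hY x₀ hx₀ _ ht₀).2.2.2.add (hk.mul_const (x - x₀))
    rw [hY0] at h1
    refine hYt.unique (h1.congr_of_eventuallyEq ?_)
    refine Filter.eventually_of_mem (Metric.isOpen_ball.mem_nhds ht₀) fun t ht => ?_
    simp only [Pi.add_apply]
    rw [hline x hx t ht]; ring
  rw [hY0] at hs hQ
  rw [hpt x hx] at hbx hPx hs hQ hinv
  refine ⟨hPx, hQ, ?_, ?_⟩
  · rw [hσ'] at hs
    exact (div_eq_iff hbx).1 hs
  · rw [← hinv]; exact mul_inv_cancel₀ hbx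

/-- `(P, Q)` is constant on the whole line through a point with `∂P/∂y ≠ 0` in the direction of the
kernel of the Jacobian. -/
theorem eq_on_line (h : HasNilpotentJacobian P Q a b c) {p : ℝ × ℝ}
    (hb : b p ≠ 0) {σ : ℝ} (hσ : a p = -σ * b p) (x : ℝ) :
    P (x, p.2 + σ * (x - p.1)) = P p ∧ Q (x, p.2 + σ * (x - p.1)) = Q p ∧
      a (x, p.2 + σ * (x - p.1)) = -σ * b (x, p.2 + σ * (x - p.1)) ∧
      b (x, p.2 + σ * (x - p.1)) ≠ 0 := by
  obtain ⟨δ, hδ, k, hk⟩ := h.exists_segment hb hσ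
  have hP : Continuous P :=
    continuous_iff_continuousAt.2 fun z => (h.hasFDerivAt_left z).continuousAt
  have hQ : Continuous Q :=
    continuous_iff_continuousAt.2 fun z => (h.hasFDerivAt_right z).continuousAt
  have ha := h.continuous_a
  have hb' := h.continuous_b
  set C : Set ℝ := {x | P (x, p.2 + σ * (x - p.1)) = P p ∧ Q (x, p.2 + σ * (x - p.1)) = Q p ∧
      a (x, p.2 + σ * (x - p.1)) = -σ * b (x, p.2 + σ * (x - p.1)) ∧
      b (x, p.2 + σ * (x - p.1)) * ((b p)⁻¹ + k * (x - p.1)) = 1} with hC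
  have hCclosed : IsClosed C := by
    refine (isClosed_eq ?_ ?_).inter ((isClosed_eq ?_ ?_).inter
      ((isClosed_eq ?_ ?_).inter (isClosed_eq ?_ ?_))) <;> fun_prop
  have hclopen : IsClopen (interior C) := by
    refine ⟨isClosed_of_closure_subset fun X hX => ?_, isOpen_interior⟩
    obtain ⟨hPX, hQX, haX, hbX⟩ : X ∈ C := closure_minimal interior_subset hCclosed hX
    obtain ⟨δ', hδ', k', hk'⟩ := h.exists_segment (left_ne_zero_of_mul_eq_one hbX) haX
    have hparam : ∀ x, p.2 + σ * (X - p.1) + σ * (x - X) = p.2 + σ * (x - p.1) := fun x => by ring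
    simp only [hparam] at hk'
    have haff : ∀ x ∈ Metric.ball X δ', x ∈ C → (b p)⁻¹ + k * (x - p.1) =
        (b (X, p.2 + σ * (X - p.1)))⁻¹ + k' * (x - X) := fun x hx hxC =>
      mul_left_cancel₀ (left_ne_zero_of_mul_eq_one hxC.2.2.2)
        (hxC.2.2.2.trans (hk' x hx).2.2.2.symm)
    have hX' := haff X (Metric.mem_ball_self hδ') ⟨hPX, hQX, haX, hbX⟩
    obtain ⟨y, hyball, hyC⟩ := mem_closure_iff.1 hX _ Metric.isOpen_ball (Metric.mem_ball_self hδ')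
    obtain ⟨η, hη, hηsub⟩ := Metric.isOpen_iff.1 (Metric.isOpen_ball.inter isOpen_interior) y
      ⟨hyball, hyC⟩
    have hy' : y + η / 2 ∈ Metric.ball y η := by simp [abs_of_pos hη, hη]
    have h1 := haff y hyball (interior_subset hyC)
    have h2 := haff _ (hηsub hy').1 (interior_subset (hηsub hy').2)
    have hkk : k = k' := by
      have : k * (η / 2) = k' * (η / 2) := by linarith
      exact mul_right_cancel₀ (half_pos hη).ne' this
    refine mem_interior.2 ⟨Metric.ball X δ', fun x hx => ?_, Metric.isOpen_ball,
      Metric.mem_ball_self hδ'⟩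
    obtain ⟨h3, h4, h5, h6⟩ := hk' x hx
    refine ⟨h3.trans hPX, h4.trans hQX, h5, ?_⟩
    rw [← h6]
    congr 1
    rw [← hkk]
    linarith
  have huniv : interior C = Set.univ := hclopen.eq_univ
    ⟨p.1, mem_interior.2 ⟨Metric.ball p.1 δ, hk, Metric.isOpen_ball, Metric.mem_ball_self hδ⟩⟩
  obtain ⟨h1, h2, h3, h4⟩ : x ∈ C := interior_subset (huniv ▸ Set.mem_univ x)
  exact ⟨h1, h2, h3, left_ne_zero_of_mul_eq_one h4⟩

/-- The kernel direction of the Jacobian is the same at all points. -/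
theorem slope_eq (h : HasNilpotentJacobian P Q a b c) {p : ℝ × ℝ}
    (hb : b p ≠ 0) {σ : ℝ} (hσ : a p = -σ * b p) (z : ℝ × ℝ) : a z = -σ * b z := by
  by_cases hz : b z = 0
  · have := h.sq_add_mul z
    rw [hz] at this ⊢
    simpa using this
  obtain ⟨τ, hτ⟩ : ∃ τ, a z = -τ * b z := ⟨-(a z / b z), by field_simp⟩
  by_cases hne : σ = τ
  · rw [hne, hτ]
  exfalso
  have hne' : σ - τ ≠ 0 := sub_ne_zero.2 hne
  set x := (z.2 - τ * z.1 - p.2 + σ * p.1) / (σ - τ) with hx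
  have hmeet : z.2 + τ * (x - z.1) = p.2 + σ * (x - p.1) := by
    have : x * (σ - τ) = z.2 - τ * z.1 - p.2 + σ * p.1 := div_mul_cancel₀ _ hne'
    linarith
  obtain ⟨-, -, h1, h2⟩ := h.eq_on_line hb hσ x
  obtain ⟨-, -, h3, -⟩ := h.eq_on_line hz hτ x
  rw [hmeet, h1] at h3
  exact hne (neg_injective (mul_right_cancel₀ h2 h3))

theorem eq_of_hasDerivAt_zero {f : ℝ → ℝ} (hf : ∀ x, HasDerivAt f 0 x) (x y : ℝ) : f x = f y :=
  is_const_of_deriv_eq_zero (fun x => (hf x).differentiableAt) (fun x => (hf x).deriv) x y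

/-- A planar `C¹` map with nilpotent Jacobian vanishing at the origin is `g(ℓ z) • w` with
`ℓ w = 0`. -/
theorem exists_shear_form (h : HasNilpotentJacobian P Q a b c) (hP0 : P (0, 0) = 0)
    (hQ0 : Q (0, 0) = 0) :
    ∃ (ℓ : (ℝ × ℝ) →L[ℝ] ℝ) (w : ℝ × ℝ) (g : ℝ → ℝ), ℓ w = 0 ∧ Continuous g ∧ g 0 = 0 ∧
      ∀ z, (P z, Q z) = g (ℓ z) • w := by
  have hP : Continuous P :=
    continuous_iff_continuousAt.2 fun z => (h.hasFDerivAt_left z).continuousAt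
  have hQ : Continuous Q :=
    continuous_iff_continuousAt.2 fun z => (h.hasFDerivAt_right z).continuousAt
  by_cases hb : ∃ p, b p ≠ 0
  · obtain ⟨p, hp⟩ := hb
    obtain ⟨σ, hσ⟩ : ∃ σ, a p = -σ * b p := ⟨-(a p / b p), by field_simp⟩
    have hslope := h.slope_eq hp hσ
    have hPform : ∀ x y, P (x, y) = P (0, y - σ * x) := fun x y => by
      have := eq_of_hasDerivAt_zero (f := fun s => P (s, y - σ * x + σ * s)) (fun s => by
        convert! h.comp_fst (hasDerivAt_id s)
          (((hasDerivAt_id s).const_mul σ).const_add (y - σ * x)) using 1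
        rw [hslope]; ring) x 0
      simpa using this
    have hQform : ∀ x y, Q (x, y) - σ * P (x, y) = Q p - σ * P p := fun x y => by
      have := eq_of_hasDerivAt_zero (f := fun s => Q (x, s) - σ * P (x, s)) (fun s => by
        convert! (h.comp_snd (hasDerivAt_const s x) (hasDerivAt_id s)).sub
          ((h.comp_fst (hasDerivAt_const s x) (hasDerivAt_id s)).const_mul σ) using 1
        rw [hslope]; ring) y (p.2 + σ * (x - p.1))
      obtain ⟨h1, h2, -, -⟩ := h.eq_on_line hp hσ x
      simpa only [h1, h2] using this
    refine ⟨ContinuousLinearMap.snd ℝ ℝ ℝ - σ • ContinuousLinearMap.fst ℝ ℝ ℝ, (1, σ),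
      fun t => P (0, t), by simp, by fun_prop, hP0, fun ⟨x, y⟩ => ?_⟩
    have h1 := hQform x y
    have h2 := hQform 0 0
    rw [hP0, hQ0] at h2
    have h3 : Q (x, y) = P (x, y) * σ := by linarith
    simp [h3, ← hPform]
  · push Not at hb
    have ha : ∀ z, a z = 0 := fun z => by simpa [hb z] using h.sq_add_mul z
    refine ⟨ContinuousLinearMap.fst ℝ ℝ ℝ, (0, 1), fun t => Q (t, 0), by simp, by fun_prop, hQ0,
      fun ⟨x, y⟩ => ?_⟩
    have h1 := eq_of_hasDerivAt_zero (f := fun s => P (s, y)) (fun s => by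
      convert! h.comp_fst (hasDerivAt_id s) (hasDerivAt_const s y) using 1
      simp [ha]) x 0
    have h2 := eq_of_hasDerivAt_zero (f := fun s => P (0, s)) (fun s => by
      convert! h.comp_fst (hasDerivAt_const s 0) (hasDerivAt_id s) using 1
      simp [hb]) y 0
    have h3 := eq_of_hasDerivAt_zero (f := fun s => Q (x, s)) (fun s => by
      convert! h.comp_snd (hasDerivAt_const s x) (hasDerivAt_id s) using 1
      simp [ha]) y 0
    simp [h1, h2, h3, hP0]

end HasNilpotentJacobian

theorem tendsto_zero_of_affine_recurrence {r : ℝ} (hr0 : 0 ≤ r) (hr1 : r < 1) {u e : ℕ → ℝ}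
    (hu : ∀ n, u (n + 1) = r * u n + e n) (he : Tendsto e atTop (𝓝 0)) :
    Tendsto u atTop (𝓝 0) := by
  rw [Metric.tendsto_atTop]
  intro ε hε
  have hη : 0 < (1 - r) * (ε / 2) := mul_pos (by linarith) (half_pos hε)
  obtain ⟨N, hN⟩ := Metric.tendsto_atTop.1 he _ hη
  have hbound : ∀ k, |u (N + k)| ≤ r ^ k * |u N| + ε / 2 := fun k => by
    induction k with
    | zero => simp; linarith
    | succ k ih =>
      have h1 := hN (N + k) (Nat.le_add_right N k)
      rw [Real.dist_0_eq_abs] at h1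
      calc |u (N + (k + 1))| = |r * u (N + k) + e (N + k)| := by rw [← add_assoc, hu]
        _ ≤ r * |u (N + k)| + |e (N + k)| := by
          simpa [abs_mul, abs_of_nonneg hr0] using abs_add_le (r * u (N + k)) (e (N + k))
        _ ≤ r * (r ^ k * |u N| + ε / 2) + (1 - r) * (ε / 2) := by gcongr
        _ = r ^ (k + 1) * |u N| + ε / 2 := by ring
  have hpow : Tendsto (fun k => r ^ k * |u N|) atTop (𝓝 0) := by
    simpa using (tendsto_pow_atTop_nhds_zero_of_lt_one hr0 hr1).mul_const |u N|
  obtain ⟨K, hK⟩ := eventually_atTop.1 (hpow.eventually_lt_const (half_pos hε))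
  refine ⟨N + K, fun n hn => ?_⟩
  obtain ⟨k, rfl⟩ := Nat.exists_eq_add_of_le (le_trans (Nat.le_add_right N K) hn)
  have h1 := hbound k
  have h2 := hK k (by omega)
  rw [Real.dist_0_eq_abs]
  linarith

/-- For `1 < c`, a map `z ↦ c • z + g (ℓ z) • w` with `ℓ w = 0` has a global inverse all of whose
orbits converge to the origin. -/
theorem exists_attracting_inverse {c : ℝ} (hc : 1 < c) {ℓ : (ℝ × ℝ) →L[ℝ] ℝ} {w : ℝ × ℝ}
    {g : ℝ → ℝ} (hw : ℓ w = 0) (hg : Continuous g) (hg0 : g 0 = 0) :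
    ∃ H : ℝ × ℝ → ℝ × ℝ, (∀ z, H (c • z + g (ℓ z) • w) = z) ∧
      (∀ z, c • H z + g (ℓ (H z)) • w = z) ∧
      ∀ z, Tendsto (fun n : ℕ => H^[n] z) atTop (𝓝 (0, 0)) := by
  have hc0 : c ≠ 0 := by positivity
  set H : ℝ × ℝ → ℝ × ℝ := fun z => c⁻¹ • (z - g (c⁻¹ * ℓ z) • w) with hH
  have hℓ : ∀ z, ℓ (H z) = c⁻¹ * ℓ z := fun z => by simp [hH, hw]
  refine ⟨H, fun z => ?_, fun z => ?_, fun z => ?_⟩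
  · simp [hH, hw, hc0]
  · rw [hℓ]
    simp [hH, hc0]
  have hr0 : 0 ≤ c⁻¹ := by positivity
  have hr1 : c⁻¹ < 1 := inv_lt_one_of_one_lt₀ hc
  have hℓn : ∀ n, ℓ (H^[n] z) = c⁻¹ ^ n * ℓ z := fun n => by
    induction n with
    | zero => simp
    | succ n ih => rw [Function.iterate_succ_apply', hℓ, ih]; ring
  have hge : Tendsto (fun n : ℕ => g (c⁻¹ * ℓ (H^[n] z))) atTop (𝓝 0) := by
    have h1 : Tendsto (fun n : ℕ => c⁻¹ * ℓ (H^[n] z)) atTop (𝓝 0) := by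
      simp only [hℓn]
      simpa using ((tendsto_pow_atTop_nhds_zero_of_lt_one hr0 hr1).mul_const (ℓ z)).const_mul c⁻¹
    have h2 := (hg.tendsto 0).comp h1
    rwa [hg0] at h2
  refine (Prod.tendsto_iff _ _).2 ⟨?_, ?_⟩
  · refine tendsto_zero_of_affine_recurrence hr0 hr1
      (e := fun n => -c⁻¹ * (g (c⁻¹ * ℓ (H^[n] z)) * w.1)) (fun n => ?_) ?_
    · rw [Function.iterate_succ_apply']
      simp only [hH, Prod.smul_fst, Prod.fst_sub, smul_eq_mul]
      ring
    · simpa using (hge.mul_const w.1).const_mul (-c⁻¹)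
  · refine tendsto_zero_of_affine_recurrence hr0 hr1
      (e := fun n => -c⁻¹ * (g (c⁻¹ * ℓ (H^[n] z)) * w.2)) (fun n => ?_) ?_
    · rw [Function.iterate_succ_apply']
      simp only [hH, Prod.smul_snd, Prod.snd_sub, smul_eq_mul]
      ring
    · simpa using (hge.mul_const w.2).const_mul (-c⁻¹)

theorem Unipotent.hasNilpotentJacobian {G : ℝ × ℝ → ℝ × ℝ} (hG : ContDiff ℝ 1 G)
    (hU : Unipotent G) :
    HasNilpotentJacobian (fun z => (G z).1 - z.1) (fun z => (G z).2 - z.2)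
      (fun z => (fderiv ℝ G z (1, 0)).1 - 1) (fun z => (fderiv ℝ G z (0, 1)).1)
      (fun z => (fderiv ℝ G z (1, 0)).2) := by
  have hd : ∀ z, HasFDerivAt G (fderiv ℝ G z) z := fun z =>
    (hG.differentiable one_ne_zero z).hasFDerivAt
  have hcont : Continuous (fderiv ℝ G) := hG.continuous_fderiv one_ne_zero
  refine ⟨fun z => ?_, fun z => ?_, fun z => ?_, by fun_prop, by fun_prop⟩
  · convert! (hd z).fst.sub hasFDerivAt_fst using 1
    ext <;> simp
  · convert! (hd z).snd.sub hasFDerivAt_snd using 1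
    have := (hU z).1
    ext <;> simp
    linarith
  · obtain ⟨h1, h2⟩ := hU z
    have h3 : (fderiv ℝ G z (0, 1)).2 = 2 - (fderiv ℝ G z (1, 0)).1 := by linarith
    rw [h3] at h2
    linarith

/-- for a nonlinear `C¹` unipotent map fixing the origin and
`-1 < μ < 0`, the perturbed map `G_μ z = G z - μ • z` is a bijection whose origin is
a global repellor: the inverse `H` has the origin as a global attractor. -/
theorem statement16 (G : ℝ × ℝ → ℝ × ℝ) (hG : ContDiff ℝ 1 G) (hU : Unipotent G)
    (hNL : NonlinearMap G) (h0 : G (0, 0) = (0, 0))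
    (μ : ℝ) (hμ : -1 < μ) (hμ0 : μ < 0)
    (Gμ : ℝ × ℝ → ℝ × ℝ) (hGμ : ∀ z : ℝ × ℝ, Gμ z = G z - μ • z) :
    Function.Bijective Gμ ∧
      ∃ H : ℝ × ℝ → ℝ × ℝ,
        (∀ z : ℝ × ℝ, H (Gμ z) = z) ∧ (∀ z : ℝ × ℝ, Gμ (H z) = z) ∧
        ∀ z : ℝ × ℝ, Tendsto (fun n : ℕ => H^[n] z) atTop (𝓝 (0, 0)) := by
  obtain ⟨ℓ, w, g, hw, hg, hg0, hform⟩ :=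
    (hU.hasNilpotentJacobian hG).exists_shear_form (by simp [h0]) (by simp [h0])
  have hGμ' : ∀ z, Gμ z = (1 - μ) • z + g (ℓ z) • w := fun z => by
    rw [hGμ, ← hform]
    ext <;> simp <;> ring
  obtain ⟨H, hl, hr, hlim⟩ := exists_attracting_inverse (c := 1 - μ) (by linarith) hw hg hg0
  simp only [← hGμ'] at hl hr
  exact ⟨⟨Function.LeftInverse.injective hl, Function.RightInverse.surjective hr⟩,
    H, hl, hr, hlim⟩
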